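/- For a cograph G on n vertices, the multiplicity of −1 as an eigenvalue of the adjacency matrix equals n minus the number of distinct closed neighborhoods, i.e., m(−1; G) = n − |{ N[v] : v ∈ V(G) }|. -/

import Mathlib

open scoped Classical

/-- A cograph is a finite simple graph with no induced path on four vertices. -/
def IsCograph {V : Type*} (G : SimpleGraph V) : Prop :=
  ¬ Nonempty (SimpleGraph.pathGraph 4 ↪g G)

def P4F {V : Type*} (G : SimpleGraph V) : Prop :=
  ∀ a b c d, G.Adj a b → G.Adj b c → G.Adj c d → ¬ G.Adj a c → ¬ G.Adj b d → ¬ G.Adj a d → False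

theorem P4F.compl {V : Type*} {G : SimpleGraph V} (h : P4F G) : P4F Gᶜ := by
  intro a b c d h1 h2 h3 h4 h5 h6
  have hac : a ≠ c := by rintro rfl; exact h6 h3
  have hbd : b ≠ d := by rintro rfl; exact h6 h1
  have had : a ≠ d := by rintro rfl; exact h4 h3.symm
  simp only [SimpleGraph.compl_adj, not_and, not_not] at *
  exact h b d a c (h5 hbd) (h6 had).symm (h4 hac) (fun h => h1.2 h.symm) (fun h => h3.2 h.symm) h2.2

theorem IsCograph.p4f {V : Type*} {G : SimpleGraph V} (h : IsCograph G) : P4F G := by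
  intro a b c d h1 h2 h3 h4 h5 h6
  have hac : a ≠ c := by rintro rfl; exact h6 h3
  have hbd : b ≠ d := by rintro rfl; exact h6 h1
  have had : a ≠ d := by rintro rfl; exact h4 h3.symm
  apply h
  have := h1.ne
  have := h2.ne
  have := h3.ne
  have s1 := h1.symm
  have s2 := h2.symm
  have s3 := h3.symm
  have s4 := fun h => h4 (SimpleGraph.Adj.symm h)
  have s5 := fun h => h5 (SimpleGraph.Adj.symm h)
  have s6 := fun h => h6 (SimpleGraph.Adj.symm h)
  refine ⟨⟨⟨![a, b, c, d], ?_⟩, ?_⟩⟩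
  · intro i j hij
    fin_cases i <;> fin_cases j <;> simp_all
  · intro i j
    simp only [SimpleGraph.pathGraph_adj]
    change G.Adj (![a, b, c, d] i) (![a, b, c, d] j) ↔ _
    fin_cases i <;> fin_cases j <;> simp_all

def Split {V : Type*} (G : SimpleGraph V) (S : Finset V) : Prop :=
  ∃ A B : Finset V, A.Nonempty ∧ B.Nonempty ∧ Disjoint A B ∧ A ∪ B = S ∧
    ∀ a ∈ A, ∀ b ∈ B, ¬ G.Adj a b

/-- one-sided step -/
theorem split_aux {V : Type*} (G : SimpleGraph V) (h : P4F G) (v : V) (A B : Finset V)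
    (hv : v ∉ A ∪ B) (hB : B.Nonempty) (hd : Disjoint A B)
    (hn : ∀ a ∈ A, ∀ b ∈ B, ¬ G.Adj a b) (q : V) (hq : q ∈ A) (hqv : ¬ G.Adj v q) :
    Split G (insert v (A ∪ B)) := by
  have hd' := Finset.disjoint_left.1 hd
  by_cases hBN : ∀ w ∈ B, ¬ G.Adj v w
  · refine ⟨insert v A, B, ⟨v, by simp⟩, hB, ?_, ?_, ?_⟩
    · rw [Finset.disjoint_left]; grind
    · grind
    · grind
  push Not at hBN
  obtain ⟨w, hw, hvw⟩ := hBN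
  by_cases hE : ∃ p ∈ A, ∃ r ∈ A, G.Adj v p ∧ ¬ G.Adj v r ∧ G.Adj p r
  · obtain ⟨p, hp, r, hr, h1, h2, h3⟩ := hE
    exact (h w v p r hvw.symm h1 h3 (fun h => hn p hp w hw h.symm) h2
      (fun h => hn r hr w hw h.symm)).elim
  · push Not at hE
    refine ⟨A.filter (fun r => ¬ G.Adj v r), insert v (A.filter (fun r => G.Adj v r) ∪ B),
      ⟨q, by simp [hq, hqv]⟩, ⟨v, by simp⟩, ?_, ?_, ?_⟩
    · rw [Finset.disjoint_left]; grind
    · ext z; grind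
    · intro a ha b hb hab
      simp only [Finset.mem_filter, Finset.mem_insert, Finset.mem_union] at ha hb
      rcases hb with rfl | hb | hb
      · exact ha.2 hab.symm
      · exact hE b hb.1 a ha.1 hb.2 ha.2 hab.symm
      · exact hn a ha.1 b hb hab

theorem split_step {V : Type*} (G : SimpleGraph V) (h : P4F G) (v : V) (S : Finset V)
    (hv : v ∉ S) (hS : Split G S) : Split G (insert v S) ∨ Split Gᶜ (insert v S) := by
  obtain ⟨A, B, hA, hB, hd, rfl, hn⟩ := hS
  by_cases hU : ∀ q ∈ A ∪ B, G.Adj v q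
  · right
    refine ⟨{v}, A ∪ B, by simp, hA.mono Finset.subset_union_left, by simpa using hv, ?_, ?_⟩
    · rw [← Finset.insert_eq]
    · intro a ha b hb
      simp only [Finset.mem_singleton] at ha
      subst ha
      simp [hU b hb]
  · left
    push Not at hU
    obtain ⟨q, hq, hqv⟩ := hU
    rcases Finset.mem_union.1 hq with hq | hq
    · exact split_aux G h v A B hv hB hd hn q hq hqv
    · rw [Finset.union_comm]
      exact split_aux G h v B A (by rwa [Finset.union_comm]) hA hd.symm
        (fun a ha b hb hab => hn b hb a ha hab.symm) q hq hqv

theorem split_all {V : Type*} (G : SimpleGraph V) (h : P4F G) (S : Finset V)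
    (hS : 2 ≤ S.card) : Split G S ∨ Split Gᶜ S := by
  induction S using Finset.induction_on with
  | empty => simp at hS
  | insert v S hv ih =>
    rw [Finset.card_insert_of_notMem hv] at hS
    by_cases h2 : 2 ≤ S.card
    · rcases ih h2 with h1 | h1
      · exact split_step G h v S hv h1
      · have := split_step Gᶜ h.compl v S hv h1
        rw [compl_compl] at this
        exact this.symm
    · have : S.card = 1 := by omega
      obtain ⟨w, rfl⟩ := Finset.card_eq_one.1 this
      by_cases hvw : G.Adj v w
      · right
        exact ⟨{v}, {w}, by simp, by simp, by simpa using hv, rfl, by simp [hvw]⟩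
      · left
        exact ⟨{v}, {w}, by simp, by simp, by simpa using hv, rfl, by simp [hvw]⟩

def HasTwins {V : Type*} (G : SimpleGraph V) (S : Finset V) : Prop :=
  ∃ u ∈ S, ∃ v ∈ S, u ≠ v ∧ ∀ c ∈ S, c ≠ u → c ≠ v → (G.Adj u c ↔ G.Adj v c)

theorem HasTwins.of_compl {V : Type*} {G : SimpleGraph V} {S : Finset V} (h : HasTwins Gᶜ S) :
    HasTwins G S := by
  obtain ⟨u, hu, v, hv, huv, h⟩ := h
  refine ⟨u, hu, v, hv, huv, fun c hc h1 h2 => ?_⟩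
  have := h c hc h1 h2
  simp only [SimpleGraph.compl_adj, h1.symm, h2.symm, ne_eq, not_false_eq_true, true_and] at this
  exact not_iff_not.1 this

theorem twins_step {V : Type*} (G : SimpleGraph V) (S : Finset V) (hS : Split G S)
    (ih : ∀ T : Finset V, T.card < S.card → 2 ≤ T.card → HasTwins G T) : HasTwins G S := by
  obtain ⟨A, B, hA, hB, hd, rfl, hn⟩ := hS
  have hc := Finset.card_union_of_disjoint hd
  have hA' := hA.card_pos
  have hB' := hB.card_pos
  have hn' : ∀ b ∈ B, ∀ a ∈ A, ¬ G.Adj b a := fun b hb a ha h => hn a ha b hb h.symm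
  by_cases h1 : 2 ≤ A.card
  · obtain ⟨u, hu, v, hv, huv, h⟩ := ih A (by omega) h1
    exact ⟨u, by simp [hu], v, by simp [hv], huv, by grind⟩
  by_cases h2 : 2 ≤ B.card
  · obtain ⟨u, hu, v, hv, huv, h⟩ := ih B (by omega) h2
    exact ⟨u, by simp [hu], v, by simp [hv], huv, by grind⟩
  obtain ⟨u, rfl⟩ := Finset.card_eq_one.1 (show A.card = 1 by omega)
  obtain ⟨v, rfl⟩ := Finset.card_eq_one.1 (show B.card = 1 by omega)
  exact ⟨u, by simp, v, by simp, by simpa using hd, by grind⟩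

theorem twins_all {V : Type*} (G : SimpleGraph V) (h : P4F G) (n : ℕ) (S : Finset V)
    (hn : S.card = n) (hS : 2 ≤ S.card) : HasTwins G S := by
  induction n using Nat.strong_induction_on generalizing S with
  | _ n ih =>
    subst hn
    rcases split_all G h S hS with h1 | h1
    · exact twins_step G S h1 (fun T hT h2 => ih _ hT T rfl h2)
    · refine HasTwins.of_compl (twins_step Gᶜ S h1 (fun T hT h2 => ?_))
      apply HasTwins.of_compl
      rw [compl_compl]
      exact ih _ hT T rfl h2

theorem real_adj (a b p q s : ℝ) (ha : 0 < a) (ha1 : a ≤ 1) (hb : 0 < b) (hb1 : b ≤ 1)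
    (hab : ¬ (a = 1 ∧ b = 1)) (h1 : a * p + q + s = 0) (h2 : p + b * q + s = 0) :
    ∃ δ : ℝ, 0 < δ ∧ δ ≤ 1 ∧ (δ = 1 → a = 1 ∨ b = 1) ∧ δ * (p + q) + s = 0 ∧
      (p + q = 0 → p = 0 ∧ q = 0) := by
  have hpos : 0 < 2 - a - b := by
    rcases lt_or_eq_of_le ha1 with h | h
    · linarith
    · rcases lt_or_eq_of_le hb1 with h' | h'
      · linarith
      · exact (hab ⟨h, h'⟩).elim
  refine ⟨(1 - a * b) / (2 - a - b), ?_, ?_, ?_, ?_, ?_⟩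
  · apply div_pos _ hpos
    nlinarith
  · rw [div_le_one hpos]
    nlinarith [mul_nonneg (sub_nonneg.2 ha1) (sub_nonneg.2 hb1)]
  · intro h
    rw [div_eq_one_iff_eq hpos.ne'] at h
    have : (a - 1) * (b - 1) = 0 := by linarith
    rcases mul_eq_zero.1 this with h | h
    · left; linarith
    · right; linarith
  · field_simp
    linear_combination (1 - b) * h1 + (1 - a) * h2
  · intro h
    have hq : q = -p := by linarith
    subst hq
    have : (2 - a - b) * p = 0 := by linarith
    rcases mul_eq_zero.1 this with h | h
    · linarith
    · simp [h]

theorem real_nadj (a b p q s : ℝ) (ha : 0 < a) (ha1 : a ≤ 1) (hb : 0 < b) (hb1 : b ≤ 1)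
    (h1 : a * p + s = 0) (h2 : b * q + s = 0) :
    ∃ δ : ℝ, 0 < δ ∧ δ < 1 ∧ δ * (p + q) + s = 0 ∧
      (p + q = 0 → p = 0 ∧ q = 0) := by
  have hpos : 0 < a + b := by linarith
  refine ⟨(a * b) / (a + b), by positivity, ?_, ?_, ?_⟩
  · rw [div_lt_one hpos]
    nlinarith
  · field_simp
    linear_combination b * h1 + a * h2
  · intro h
    have hq : q = -p := by linarith
    subst hq
    have : (a + b) * p = 0 := by linarith
    rcases mul_eq_zero.1 this with h | h
    · linarith
    · simp [h]

theorem main_aux {V : Type*} (G : SimpleGraph V) (h : P4F G) (n : ℕ) (S : Finset V)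
    (hn : S.card = n) (d x : V → ℝ) (hd : ∀ a ∈ S, 0 < d a ∧ d a ≤ 1)
    (ht : ∀ a ∈ S, ∀ b ∈ S, G.Adj a b →
      (∀ c ∈ S, c ≠ a → c ≠ b → (G.Adj a c ↔ G.Adj b c)) → d a = 1 → d b = 1 → False)
    (hx : ∀ a ∈ S, d a * x a + ∑ b ∈ S, (if G.Adj a b then x b else 0) = 0) :
    ∀ a ∈ S, x a = 0 := by
  induction n generalizing S d x with
  | zero =>
    rw [Finset.card_eq_zero] at hn
    simp [hn]
  | succ n ih =>
    by_cases h2 : 2 ≤ S.card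
    swap
    · obtain ⟨u, rfl⟩ := Finset.card_eq_one.1 (show S.card = 1 by omega)
      intro a ha
      have h1 := hx a ha
      have h3 := hd a ha
      rw [Finset.mem_singleton] at ha
      subst ha
      simp at h1
      rcases h1 with h1 | h1
      · linarith
      · exact h1
    obtain ⟨u, hu, v, hv, huv, htw⟩ := twins_all G h _ S rfl h2
    obtain ⟨T, hT⟩ : ∃ T, T = (S.erase v).erase u := ⟨_, rfl⟩
    have huT : u ∉ T := by simp [hT]
    have hvT : v ∉ T := by simp [hT]
    have hS : S = insert u (insert v T) := by
      rw [hT]; ext z; grind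
    clear hT
    subst hS
    have huvT : u ∉ insert v T := by simp [huT, huv]
    have hcard : (insert u T).card = n := by
      rw [Finset.card_insert_of_notMem huvT, Finset.card_insert_of_notMem hvT] at hn
      rw [Finset.card_insert_of_notMem huT]; omega
    have htw' : ∀ c ∈ T, (G.Adj u c ↔ G.Adj v c) := by
      intro c hc
      exact htw c (by simp [hc]) (by rintro rfl; exact huT hc) (by rintro rfl; exact hvT hc)
    obtain ⟨s, hs⟩ : ∃ s, s = ∑ b ∈ T, (if G.Adj u b then x b else 0) := ⟨_, rfl⟩
    have hs' : ∑ b ∈ T, (if G.Adj v b then x b else 0) = s := by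
      rw [hs]; apply Finset.sum_congr rfl
      intro c hc; simp only [htw' c hc]
    have hxu := hx u (by simp)
    have hxv := hx v (by simp)
    simp only [Finset.sum_insert huvT, Finset.sum_insert hvT, ← hs, hs', SimpleGraph.irrefl,
      if_false] at hxu hxv
    obtain ⟨hu0, hu1⟩ := hd u (by simp)
    obtain ⟨hv0, hv1⟩ := hd v (by simp)
    obtain ⟨δ, hδ0, hδ1, hδ, hδx, hδz⟩ : ∃ δ : ℝ, 0 < δ ∧ δ ≤ 1 ∧
        (δ = 1 → G.Adj u v ∧ (d u = 1 ∨ d v = 1)) ∧ δ * (x u + x v) + s = 0 ∧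
        (x u + x v = 0 → x u = 0 ∧ x v = 0) := by
      by_cases ha : G.Adj u v
      · simp only [ha, ha.symm, if_true] at hxu hxv
        obtain ⟨δ, a1, a2, a3, a4, a5⟩ := real_adj (d u) (d v) (x u) (x v) s hu0 hu1 hv0 hv1
          (fun h => ht u hu v hv ha htw h.1 h.2) (by linarith) (by linarith)
        exact ⟨δ, a1, a2, fun h => ⟨ha, a3 h⟩, a4, a5⟩
      · have ha' : ¬ G.Adj v u := fun h => ha h.symm
        simp only [ha, ha', if_false] at hxu hxv
        obtain ⟨δ, a1, a2, a4, a5⟩ := real_nadj (d u) (d v) (x u) (x v) s hu0 hu1 hv0 hv1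
          (by linarith) (by linarith)
        exact ⟨δ, a1, a2.le, fun h => absurd h a2.ne, a4, a5⟩
    have hneT : ∀ c ∈ T, c ≠ u ∧ c ≠ v := fun c hc =>
      ⟨by rintro rfl; exact huT hc, by rintro rfl; exact hvT hc⟩
    -- no twin of u in T with weight one
    have key : δ = 1 → ∀ b ∈ T, G.Adj u b →
        (∀ c ∈ T, c ≠ b → (G.Adj u c ↔ G.Adj b c)) → d b = 1 → False := by
      intro h1 b hb hub hc hb1
      obtain ⟨huv', h1 | h1⟩ := hδ h1
      · refine ht u hu b (by simp [hb]) hub ?_ h1 hb1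
        intro c hcS h3 h4
        rcases Finset.mem_insert.1 hcS with rfl | hcS
        · exact (h3 rfl).elim
        rcases Finset.mem_insert.1 hcS with rfl | hcS
        · exact iff_of_true huv' ((htw' b hb).1 hub).symm
        · exact hc c hcS h4
      · refine ht v hv b (by simp [hb]) ((htw' b hb).1 hub) ?_ h1 hb1
        intro c hcS h3 h4
        rcases Finset.mem_insert.1 hcS with rfl | hcS
        · exact iff_of_true huv'.symm hub.symm
        rcases Finset.mem_insert.1 hcS with rfl | hcS
        · exact (h3 rfl).elim
        · rw [← htw' c hcS]; exact hc c hcS h4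
    have hsumT : ∀ a, ∑ b ∈ T, (if G.Adj a b then Function.update x u (x u + x v) b else 0) =
        ∑ b ∈ T, (if G.Adj a b then x b else 0) := by
      intro a
      apply Finset.sum_congr rfl
      intro c hc
      rw [Function.update_of_ne (hneT c hc).1]
    have fin := ih (insert u T) hcard (Function.update d u δ) (Function.update x u (x u + x v))
      (by
        intro a ha
        rcases Finset.mem_insert.1 ha with rfl | ha
        · simp [hδ0, hδ1]
        · rw [Function.update_of_ne (hneT a ha).1]
          exact hd a (by simp [ha]))
      (by
        intro a haS b hbS hab hc hda hdb
        rcases Finset.mem_insert.1 haS with rfl | ha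
        · rcases Finset.mem_insert.1 hbS with rfl | hb
          · exact G.irrefl hab
          · rw [Function.update_of_ne (hneT b hb).1] at hdb
            rw [Function.update_self] at hda
            exact key hda b hb hab
              (fun c h1 h2 => hc c (by simp [h1]) (hneT c h1).1 h2) hdb
        · rw [Function.update_of_ne (hneT a ha).1] at hda
          rcases Finset.mem_insert.1 hbS with rfl | hb
          · rw [Function.update_self] at hdb
            exact key hdb a ha hab.symm
              (fun c h1 h2 => (hc c (by simp [h1]) h2 (hneT c h1).1).symm) hda
          · rw [Function.update_of_ne (hneT b hb).1] at hdb
            refine ht a (by simp [ha]) b (by simp [hb]) hab ?_ hda hdb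
            intro c hcS h3 h4
            have hcu := hc u (by simp) (hneT a ha).1.symm (hneT b hb).1.symm
            rcases Finset.mem_insert.1 hcS with rfl | hcS
            · exact hcu
            rcases Finset.mem_insert.1 hcS with rfl | hcS
            · rw [G.adj_comm a, G.adj_comm b, ← htw' a ha, ← htw' b hb, G.adj_comm _ a,
                G.adj_comm _ b]
              exact hcu
            · exact hc c (by simp [hcS]) h3 h4)
      (by
        intro a ha
        rw [Finset.sum_insert huT, hsumT]
        rcases Finset.mem_insert.1 ha with rfl | ha
        · simp only [Function.update_self, SimpleGraph.irrefl, if_false, ← hs]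
          linarith
        · rw [Function.update_of_ne (hneT a ha).1, Function.update_of_ne (hneT a ha).1,
            Function.update_self]
          have h1 := hx a (by simp [ha])
          rw [Finset.sum_insert huvT, Finset.sum_insert hvT] at h1
          have h3 : G.Adj a u ↔ G.Adj a v := by
            rw [G.adj_comm a, G.adj_comm a]; exact htw' a ha
          by_cases h4 : G.Adj a u
          · have h5 := h3.1 h4
            simp only [h4, h5, if_true] at h1 ⊢
            linarith
          · have h5 : ¬ G.Adj a v := fun h => h4 (h3.2 h)
            simp only [h4, h5, if_false] at h1 ⊢
            linarith)
    have hz := fin u (by simp)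
    rw [Function.update_self] at hz
    obtain ⟨z1, z2⟩ := hδz hz
    intro a ha
    rcases Finset.mem_insert.1 ha with rfl | ha
    · exact z1
    rcases Finset.mem_insert.1 ha with rfl | ha
    · exact z2
    · have := fin a (by simp [ha])
      rwa [Function.update_of_ne (hneT a ha).1] at this

/-- For a cograph `G` on `n` vertices, the multiplicity of `-1` as an adjacency
eigenvalue (the dimension of the kernel of `A - (-1)I = A + I`) equals `n` minus the
number of distinct closed neighborhoods. -/
theorem cograph_mult_neg_one {V : Type*} [Fintype V] (G : SimpleGraph V)
    (hG : IsCograph G) :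
    Module.finrank ℝ (LinearMap.ker (Matrix.toLin' (G.adjMatrix ℝ + 1))) =
      Fintype.card V - {S : Set V | ∃ v, S = insert v (G.neighborSet v)}.ncard := by
  obtain ⟨N, hN⟩ : ∃ N : V → Set V, N = fun v => insert v (G.neighborSet v) := ⟨_, rfl⟩
  have hmem : ∀ a b, a ∈ N b ↔ (a = b ∨ G.Adj a b) := by
    intro a b; simp [hN, G.adj_comm]
  have hsymm : ∀ a b, a ∈ N b ↔ b ∈ N a := by
    intro a b; rw [hmem, hmem, G.adj_comm, eq_comm]
  have hset : {S : Set V | ∃ v, S = insert v (G.neighborSet v)} = Set.range N := by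
    ext S; simp [hN, eq_comm]
  rw [hset]
  obtain ⟨σ, hσ⟩ : ∃ σ : Set.range N → V, ∀ t, N (σ t) = t :=
    ⟨Set.rangeSplitting N, fun t => Set.apply_rangeSplitting N t⟩
  obtain ⟨π, hπ⟩ : ∃ π : V → Set.range N, ∀ v, (π v : Set V) = N v :=
    ⟨fun v => ⟨N v, v, rfl⟩, fun v => rfl⟩
  have hπσ : ∀ t, π (σ t) = t := fun t => Subtype.ext (by rw [hπ, hσ])
  have hσi : Function.Injective σ := Function.LeftInverse.injective hπσ
  let φ : (V → ℝ) →ₗ[ℝ] (Set.range N → ℝ) :=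
    { toFun := fun x t => ∑ v, if π v = t then x v else 0
      map_add' := by
        intro x y; ext t
        simp only [Pi.add_apply, ← Finset.sum_add_distrib]
        apply Finset.sum_congr rfl
        intro v _; split_ifs <;> simp
      map_smul' := by
        intro c x; ext t
        simp only [Pi.smul_apply, smul_eq_mul, RingHom.id_apply, Finset.mul_sum]
        apply Finset.sum_congr rfl
        intro v _; split_ifs <;> simp }
  have hφ : ∀ x t, φ x t = ∑ v, if π v = t then x v else 0 := fun _ _ => rfl
  have hM : ∀ x a, Matrix.toLin' (G.adjMatrix ℝ + 1) x a =
      ∑ b, if a ∈ N b then x b else 0 := by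
    intro x a
    rw [Matrix.toLin'_apply]
    simp only [Matrix.mulVec, dotProduct, Matrix.add_apply, SimpleGraph.adjMatrix_apply,
      Matrix.one_apply, hmem]
    apply Finset.sum_congr rfl
    intro b _
    by_cases h1 : a = b
    · subst h1; simp
    · by_cases h2 : G.Adj a b <;> simp [h1, h2]
  have hMφ : ∀ x a, Matrix.toLin' (G.adjMatrix ℝ + 1) x a =
      ∑ t : Set.range N, if a ∈ (t : Set V) then φ x t else 0 := by
    intro x a
    rw [hM]
    have : ∀ t : Set.range N, (if a ∈ (t : Set V) then φ x t else 0) =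
        ∑ v, if π v = t then (if a ∈ N v then x v else 0) else 0 := by
      intro t
      rw [hφ]
      split_ifs with h1
      · apply Finset.sum_congr rfl
        intro v _
        by_cases h2 : π v = t
        · have : a ∈ N v := by rw [← hπ, h2]; exact h1
          simp [h2, this]
        · simp [h2]
      · symm
        apply Finset.sum_eq_zero
        intro v _
        by_cases h2 : π v = t
        · have : a ∉ N v := by rw [← hπ, h2]; exact h1
          simp [this]
        · simp [h2]
    simp only [this]
    rw [Finset.sum_comm]
    simp
  have hker : LinearMap.ker (Matrix.toLin' (G.adjMatrix ℝ + 1)) = LinearMap.ker φ := by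
    ext x
    rw [LinearMap.mem_ker, LinearMap.mem_ker]
    constructor
    · intro h
      have main := main_aux G hG.p4f _ (Finset.univ.image σ) rfl (fun _ => 1)
        (fun v => φ x (π v)) (fun _ _ => ⟨one_pos, le_refl _⟩) ?_ ?_
      · ext t
        have := main (σ t) (by simp)
        simpa [hπσ] using this
      · intro a ha b hb hab hc _ _
        obtain ⟨t, -, rfl⟩ := Finset.mem_image.1 ha
        obtain ⟨t', -, rfl⟩ := Finset.mem_image.1 hb
        have hr : ∀ r : Set.range N, σ r ∈ N (σ t) ↔ σ r ∈ N (σ t') := by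
          intro r
          rw [hmem, hmem]
          by_cases h1 : σ r = σ t
          · rw [h1]; exact iff_of_true (Or.inl rfl) (Or.inr hab)
          by_cases h2 : σ r = σ t'
          · rw [h2]; exact iff_of_true (Or.inr hab.symm) (Or.inl rfl)
          simp only [h1, h2, false_or]
          rw [G.adj_comm, G.adj_comm (σ r)]
          exact hc (σ r) (by simp) h1 h2
        have : N (σ t) = N (σ t') := by
          ext w
          have := hr (π w)
          rw [hsymm, hsymm _ (σ t'), hσ, hπ] at this
          rw [hsymm, hsymm w]; exact this
        rw [hσ, hσ] at this
        have := Subtype.ext this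
        subst this
        exact G.irrefl hab
      · intro a ha
        have h1 := congrFun h a
        rw [hMφ, Pi.zero_apply] at h1
        obtain ⟨t, -, rfl⟩ := Finset.mem_image.1 ha
        rw [Finset.sum_image (fun _ _ _ _ h => hσi h)]
        simp only [hπσ, one_mul]
        refine Eq.trans ?_ h1
        have h2 : φ x t = ∑ r, if r = t then φ x r else 0 := by simp
        rw [h2, ← Finset.sum_add_distrib]
        apply Finset.sum_congr rfl
        intro r _
        rw [← hσ r, hmem]
        by_cases h3 : r = t
        · subst h3; simp
        · have h4 : σ t ≠ σ r := fun h => h3 (hσi h).symm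
          simp [h3, h4]
    · intro h
      ext a
      rw [hMφ, h]
      simp
  have hsurj : Function.Surjective φ := by
    intro y
    refine ⟨fun v => if v = σ (π v) then y (π v) else 0, ?_⟩
    ext t
    rw [hφ, Finset.sum_eq_single (σ t)]
    · simp [hπσ]
    · intro v _ hv
      by_cases h1 : π v = t
      · subst h1; simp [hv]
      · simp [h1]
    · simp
  have hrn := LinearMap.finrank_range_add_finrank_ker φ
  rw [LinearMap.range_eq_top.2 hsurj, finrank_top, Module.finrank_fintype_fun_eq_card,
    Module.finrank_fintype_fun_eq_card] at hrn
  rw [hker, ← Nat.card_coe_set_eq, Nat.card_eq_fintype_card]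
  omega
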